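/- arXiv:2306.12158 — 2 statements merged into one kernel-verified Lean document; each statement's English description precedes it below -/
import Mathlib

section
/- For every k ≥ 1, |AMS_{3k}| = 2|AMS_{3k−1}| − |{M ∈ AMS_{3k−1} : |M| = 2k−1}|. -/
/-- `w` (read on positions `1,…,2n`) is a Stirling permutation of order `n`:
each value `1,…,n` appears exactly twice, all letters lie in `[1,n]`, and every
value between the two copies of a value exceeds it. -/
def IsStirling (n : ℕ) (w : ℕ → ℕ) : Prop :=
  (∀ k, 1 ≤ k → k ≤ n → ((Finset.Icc 1 (2*n)).filter (fun i => w i = k)).card = 2) ∧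
  (∀ i, 1 ≤ i → i ≤ 2*n → 1 ≤ w i ∧ w i ≤ n) ∧
  (∀ i j l, 1 ≤ i → i < j → j < l → l ≤ 2*n → w i = w l → w i < w j)

/-- The set of mesas of `w`: values `m` with `w(i-1) < w(i) = w(i+1) = m > w(i+2)`
for some `2 ≤ i ≤ 2n-2`. -/
def MesaSet (n : ℕ) (w : ℕ → ℕ) : Set ℕ :=
  {m | ∃ i, 2 ≤ i ∧ i + 2 ≤ 2*n ∧ w (i-1) < w i ∧ w i = w (i+1) ∧ w (i+2) < w i ∧ w i = m}

/-- The collection of admissible mesa sets of order `n`. -/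
def AMS (n : ℕ) : Set (Set ℕ) := {M | ∃ w, IsStirling n w ∧ MesaSet n w = M}

lemma stirling_two {n : ℕ} {w : ℕ → ℕ} (h : IsStirling n w) (k : ℕ) (h1 : 1 ≤ k) (h2 : k ≤ n) :
    ∃ a b, 1 ≤ a ∧ a < b ∧ b ≤ 2*n ∧ w a = k ∧ w b = k ∧
      ∀ i, 1 ≤ i → i ≤ 2*n → w i = k → i = a ∨ i = b := by
  obtain ⟨x, y, hxy, hs⟩ := Finset.card_eq_two.1 (h.1 k h1 h2)
  have key : ∀ i, (1 ≤ i ∧ i ≤ 2*n) ∧ w i = k ↔ i = x ∨ i = y := by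
    intro i
    have := Finset.ext_iff.1 hs i
    simpa using this
  have hx := (key x).2 (Or.inl rfl)
  have hy := (key y).2 (Or.inr rfl)
  rcases lt_or_gt_of_ne hxy with hlt | hlt
  · exact ⟨x, y, by omega, hlt, by omega, hx.2, hy.2, fun i a b c => (key i).1 ⟨⟨a, b⟩, c⟩⟩
  · exact ⟨y, x, by omega, hlt, by omega, hy.2, hx.2, fun i a b c => ((key i).1 ⟨⟨a, b⟩, c⟩).symm⟩

lemma two_card {n : ℕ} {w : ℕ → ℕ} (k : ℕ)
    (h : ∃ a b, 1 ≤ a ∧ a < b ∧ b ≤ 2*n ∧ w a = k ∧ w b = k ∧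
      ∀ i, 1 ≤ i → i ≤ 2*n → w i = k → i = a ∨ i = b) :
    ((Finset.Icc 1 (2*n)).filter (fun i => w i = k)).card = 2 := by
  obtain ⟨a, b, h1, h2, h3, h4, h5, h6⟩ := h
  refine Finset.card_eq_two.2 ⟨a, b, by omega, ?_⟩
  ext i
  simp only [Finset.mem_filter, Finset.mem_Icc, Finset.mem_insert, Finset.mem_singleton]
  constructor
  · rintro ⟨⟨x, y⟩, z⟩; exact h6 i x y z
  · rintro (rfl | rfl)
    · exact ⟨by omega, h4⟩
    · exact ⟨by omega, h5⟩

/-- insert `v v` after position `p` -/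
def insW (w : ℕ → ℕ) (p v : ℕ) : ℕ → ℕ :=
  fun i => if i ≤ p then w i else if i ≤ p + 2 then v else w (i-2)

lemma insW_lo (w : ℕ → ℕ) (p v i : ℕ) (h : i ≤ p) : insW w p v i = w i := by simp [insW, h]
lemma insW_mid (w : ℕ → ℕ) (p v i : ℕ) (h : p < i) (h2 : i ≤ p + 2) : insW w p v i = v := by
  simp [insW, h2, Nat.not_le.2 h]
lemma insW_hi (w : ℕ → ℕ) (p v i : ℕ) (h : p + 2 < i) : insW w p v i = w (i-2) := by
  have : ¬ i ≤ p := by omega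
  simp [insW, this, Nat.not_le.2 h]

/-- delete positions `p, p+1` -/
def delW (w : ℕ → ℕ) (p : ℕ) : ℕ → ℕ := fun i => if i < p then w i else w (i+2)

lemma delW_lo (w : ℕ → ℕ) (p i : ℕ) (h : i < p) : delW w p i = w i := by simp [delW, h]
lemma delW_hi (w : ℕ → ℕ) (p i : ℕ) (h : p ≤ i) : delW w p i = w (i+2) := by
  simp [delW, Nat.not_lt.2 h]

lemma insW_cases (w : ℕ → ℕ) (p v i : ℕ) : (i ≤ p ∧ insW w p v i = w i) ∨
    (p < i ∧ i ≤ p+2 ∧ insW w p v i = v) ∨ (p + 2 < i ∧ insW w p v i = w (i-2)) := by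
  rcases Nat.lt_or_ge p i with h | h
  · rcases Nat.lt_or_ge (p+2) i with h2 | h2
    · exact Or.inr (Or.inr ⟨h2, insW_hi w p v i h2⟩)
    · exact Or.inr (Or.inl ⟨h, h2, insW_mid w p v i h h2⟩)
  · exact Or.inl ⟨h, insW_lo w p v i h⟩

lemma stirling_ins {n : ℕ} {w : ℕ → ℕ} (h : IsStirling n w) (p : ℕ) (hp : p ≤ 2*n) :
    IsStirling (n+1) (insW w p (n+1)) := by
  have hb := h.2.1
  have hc := h.2.2
  refine ⟨?_, ?_, ?_⟩
  · intro k h1 h2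
    apply two_card
    rcases Nat.lt_or_ge n k with hk | hk
    · refine ⟨p+1, p+2, by omega, by omega, by omega, ?_, ?_, ?_⟩
      · rw [insW_mid _ _ _ _ (by omega) (by omega)]; omega
      · rw [insW_mid _ _ _ _ (by omega) (by omega)]; omega
      · intro i hi1 hi2 hi3
        rcases insW_cases w p (n+1) i with ⟨h4, h5⟩ | ⟨h4, h5, h6⟩ | ⟨h4, h5⟩
        · have := hb i hi1 (by omega); omega
        · omega
        · have := hb (i-2) (by omega) (by omega); omega
    · obtain ⟨a, b, ha, hab, hb2, hwa, hwb, hall⟩ := stirling_two h k h1 hk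
      have sh : ∀ c, ∃ c', (c ≤ p ∧ c' = c ∨ p < c ∧ c' = c + 2) ∧ insW w p (n+1) c' = w c := by
        intro c
        rcases Nat.lt_or_ge p c with hc | hc
        · exact ⟨c+2, by omega, by rw [insW_hi _ _ _ _ (by omega)]; simp⟩
        · exact ⟨c, by omega, insW_lo _ _ _ _ hc⟩
      obtain ⟨a', ha1, ha2⟩ := sh a
      obtain ⟨b', hb1, hb3⟩ := sh b
      refine ⟨a', b', by omega, by omega, by omega, by omega, by omega, ?_⟩
      intro i hi1 hi2 hi3
      rcases insW_cases w p (n+1) i with ⟨h4, h5⟩ | ⟨h4, h5, h6⟩ | ⟨h4, h5⟩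
      · have := hall i hi1 (by omega) (by omega); omega
      · omega
      · have := hall (i-2) (by omega) (by omega) (by omega); omega
  · intro i hi1 hi2
    rcases insW_cases w p (n+1) i with ⟨h4, h5⟩ | ⟨h4, h5, h6⟩ | ⟨h4, h5⟩
    · have := hb i hi1 (by omega); omega
    · omega
    · have := hb (i-2) (by omega) (by omega); omega
  · intro i j l hi hij hjl hl heq
    rcases insW_cases w p (n+1) i with ⟨i4, i5⟩ | ⟨i4, i6, i5⟩ | ⟨i4, i5⟩ <;>
    rcases insW_cases w p (n+1) j with ⟨j4, j5⟩ | ⟨j4, j6, j5⟩ | ⟨j4, j5⟩ <;>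
    rcases insW_cases w p (n+1) l with ⟨l4, l5⟩ | ⟨l4, l6, l5⟩ | ⟨l4, l5⟩ <;>
    first
    | omega
    | (have := hb i hi (by omega); omega)
    | (have := hb (l-2) (by omega) (by omega); omega)
    | (have := hc i j l hi hij hjl (by omega) (by omega); omega)
    | (have := hc i j (l-2) hi hij (by omega) (by omega) (by omega); omega)
    | (have := hc i (j-2) (l-2) hi (by omega) (by omega) (by omega) (by omega); omega)
    | (have := hc (i-2) (j-2) (l-2) (by omega) (by omega) (by omega) (by omega) (by omega); omega)

lemma mesa_ins_sub {n : ℕ} {w : ℕ → ℕ} (h : IsStirling n w) (p : ℕ) (hp : p ≤ 2*n) (m : ℕ)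
    (hm : m ∈ MesaSet (n+1) (insW w p (n+1))) :
    m ∈ MesaSet n w ∨ (m = n+1 ∧ 1 ≤ p) := by
  have hb := h.2.1
  obtain ⟨i, h2, h3, h4, h5, h6, h7⟩ := hm
  by_cases c1 : i = p+1
  · right
    subst c1
    rw [insW_mid _ _ _ _ (by omega) (by omega)] at h7
    omega
  left
  by_cases c2 : i + 2 ≤ p
  · rw [insW_lo _ _ _ _ (by omega)] at h4 h5 h6 h7
    rw [insW_lo _ _ _ _ (by omega)] at h4 h5 h6
    exact ⟨i, h2, by omega, h4, h5, h6, h7⟩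
  by_cases c3 : p + 4 ≤ i
  · rw [insW_hi _ _ _ _ (by omega)] at h4 h5 h6 h7
    rw [insW_hi _ _ _ _ (by omega)] at h4 h5 h6
    refine ⟨i-2, by omega, by omega, ?_, ?_, ?_, h7⟩
    · rw [show i - 2 - 1 = i - 1 - 2 by omega]; exact h4
    · convert h5 using 2; omega
    · convert h6 using 2; omega
  exfalso
  have hle : insW w p (n+1) i ≤ n + 1 := ((stirling_ins h p hp).2.1 i (by omega) (by omega)).2
  have e1 := insW_mid w p (n+1) (p+1) (by omega) (by omega)
  have e2 := insW_mid w p (n+1) (p+2) (by omega) (by omega)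
  have : i + 1 = p ∨ i = p ∨ i = p+2 ∨ i = p + 3 := by omega
  rcases this with rfl | rfl | rfl | rfl
  · rw [show i + 1 + 1 = i + 2 by omega] at e1
    omega
  · have := hb i (by omega) hp
    rw [insW_lo _ _ _ _ (le_refl i)] at h5
    omega
  · rw [show p + 2 - 1 = p + 1 by omega] at h4
    omega
  · rw [show p + 3 - 1 = p + 2 by omega] at h4
    omega

/-- mesa positions -/
def mpos (n : ℕ) (w : ℕ → ℕ) : Finset ℕ :=
  (Finset.Icc 2 (2*n)).filter
    (fun i => i + 2 ≤ 2*n ∧ w (i-1) < w i ∧ w i = w (i+1) ∧ w (i+2) < w i)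

lemma mem_mpos {n : ℕ} {w : ℕ → ℕ} {i : ℕ} : i ∈ mpos n w ↔
    2 ≤ i ∧ i + 2 ≤ 2*n ∧ w (i-1) < w i ∧ w i = w (i+1) ∧ w (i+2) < w i := by
  simp only [mpos, Finset.mem_filter, Finset.mem_Icc]
  constructor
  · rintro ⟨a, b⟩; exact ⟨a.1, b⟩
  · rintro ⟨a, b⟩; exact ⟨⟨a, by omega⟩, b⟩

lemma mesa_eq (n : ℕ) (w : ℕ → ℕ) : MesaSet n w = ((mpos n w).image w : Finset ℕ) := by
  ext m
  simp only [Finset.coe_image, Set.mem_image, Finset.mem_coe, mem_mpos, MesaSet, Set.mem_ofPred_eq]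
  constructor
  · rintro ⟨i, a, b, c, d, e, f⟩; exact ⟨i, ⟨a, b, c, d, e⟩, f⟩
  · rintro ⟨i, ⟨a, b, c, d, e⟩, f⟩; exact ⟨i, a, b, c, d, e, f⟩

lemma mpos_sep {n : ℕ} {w : ℕ → ℕ} {i j : ℕ} (hi : i ∈ mpos n w) (hj : j ∈ mpos n w)
    (hij : i < j) : i + 3 ≤ j := by
  rw [mem_mpos] at hi hj
  by_contra hc
  have : j = i + 1 ∨ j = i + 2 := by omega
  rcases this with rfl | rfl
  · have := hj.2.2.2.1
    rw [show i + 1 + 1 = i + 2 by omega] at this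
    omega
  · have := hj.2.2.1
    rw [show i + 2 - 1 = i + 1 by omega] at this
    omega

lemma mesa_ncard {n : ℕ} {w : ℕ → ℕ} (h : IsStirling n w) :
    (MesaSet n w).ncard = (mpos n w).card := by
  rw [mesa_eq, Set.ncard_coe_finset, Finset.card_image_of_injOn]
  have key : ∀ i ∈ mpos n w, ∀ j ∈ mpos n w, i < j → w i ≠ w j := by
    intro i hi j hj hij heq
    have hs := mpos_sep hi hj hij
    rw [mem_mpos] at hi hj
    have := h.2.2 i (i+1) j (by omega) (by omega) (by omega) (by omega) heq
    omega
  intro i hi j hj heq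
  by_contra hne
  rcases lt_or_gt_of_ne hne with hl | hl
  · exact key i hi j hj hl heq
  · exact key j hj i hi hl heq.symm

/-- blocked gaps -/
def blocked (n : ℕ) (w : ℕ → ℕ) : Finset ℕ :=
  (mpos n w ×ˢ Finset.range 3).image (fun x => x.1 + x.2 - 1)

lemma blocked_card (n : ℕ) (w : ℕ → ℕ) : (blocked n w).card = 3 * (mpos n w).card := by
  rw [blocked, Finset.card_image_of_injOn]
  · simp [mul_comm]
  · rintro ⟨i, a⟩ hi ⟨j, b⟩ hj heq
    simp only [Finset.coe_product, Set.mem_prod, Finset.mem_coe, Finset.mem_range] at hi hj heq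
    have h1 := (mem_mpos.1 hi.1).1
    have h2 := (mem_mpos.1 hj.1).1
    rcases lt_trichotomy i j with hl | hl | hl
    · have := mpos_sep hi.1 hj.1 hl
      omega
    · subst hl
      have : a = b := by omega
      rw [this]
    · have := mpos_sep hj.1 hi.1 hl
      omega

lemma blocked_sub (n : ℕ) (w : ℕ → ℕ) : blocked n w ⊆ Finset.Icc 1 (2*n-1) := by
  intro x hx
  simp only [blocked, Finset.mem_image, Finset.mem_product, Finset.mem_range] at hx
  obtain ⟨⟨i, a⟩, ⟨h1, h2⟩, h3⟩ := hx
  have := mem_mpos.1 h1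
  simp only at h1 h2 h3 this
  rw [Finset.mem_Icc]
  omega

lemma mesa_bound {n : ℕ} (hn : 1 ≤ n) {w : ℕ → ℕ} (h : IsStirling n w) :
    3 * (MesaSet n w).ncard + 1 ≤ 2 * n := by
  rw [mesa_ncard h, ← blocked_card]
  have := Finset.card_le_card (blocked_sub n w)
  simp at this
  omega

lemma AMS_up {n : ℕ} {M : Set ℕ} (h : M ∈ AMS n) : M ∈ AMS (n+1) := by
  obtain ⟨w, hw, rfl⟩ := h
  refine ⟨insW w 0 (n+1), stirling_ins hw 0 (by omega), ?_⟩
  ext m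
  constructor
  · intro hm
    rcases mesa_ins_sub hw 0 (by omega) m hm with h | h
    · exact h
    · omega
  · rintro ⟨i, a, b, c, d, e, f⟩
    refine ⟨i+2, by omega, by omega, ?_⟩
    rw [insW_hi _ _ _ _ (by omega), insW_hi _ _ _ _ (by omega), insW_hi _ _ _ _ (by omega),
      insW_hi _ _ _ _ (by omega)]
    exact ⟨by rw [show i + 2 - 1 - 2 = i - 1 by omega]; exact c, d, e, f⟩

lemma AMS_ins {n : ℕ} {M : Set ℕ} (h : M ∈ AMS n) (hc : 3 * M.ncard + 2 ≤ 2 * n) :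
    insert (n+1) M ∈ AMS (n+1) := by
  obtain ⟨w, hw, rfl⟩ := h
  have hcard : (blocked n w).card < (Finset.Icc 1 (2*n-1)).card := by
    rw [mesa_ncard hw] at hc
    rw [blocked_card]
    simp
    omega
  obtain ⟨p, hp, hpb⟩ := Finset.exists_mem_notMem_of_card_lt_card hcard
  rw [Finset.mem_Icc] at hp
  have hb := hw.2.1
  refine ⟨insW w p (n+1), stirling_ins hw p (by omega), ?_⟩
  ext m
  constructor
  · intro hm
    rcases mesa_ins_sub hw p (by omega) m hm with h | h
    · exact Or.inr h
    · exact Or.inl h.1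
  · rintro (rfl | hm)
    · refine ⟨p+1, by omega, by omega, ?_⟩
      have e1 := insW_mid w p (n+1) (p+1) (by omega) (by omega)
      have e2 := insW_mid w p (n+1) (p+2) (by omega) (by omega)
      have e3 := insW_lo w p (n+1) p (by omega)
      have e4 := insW_hi w p (n+1) (p+3) (by omega)
      have b1 := hb p (by omega) (by omega)
      have b2 := hb (p+1) (by omega) (by omega)
      rw [show p + 3 - 2 = p + 1 by omega] at e4
      change insW w p (n+1) p < insW w p (n+1) (p+1) ∧
        insW w p (n+1) (p+1) = insW w p (n+1) (p+2) ∧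
        insW w p (n+1) (p+3) < insW w p (n+1) (p+1) ∧ insW w p (n+1) (p+1) = n + 1
      omega
    · obtain ⟨i, a, b, c, d, e, f⟩ := hm
      have him : i ∈ mpos n w := mem_mpos.2 ⟨a, b, c, d, e⟩
      have hne : ∀ r, r < 3 → i + r - 1 ≠ p := by
        intro r hr he
        apply hpb
        simp only [blocked, Finset.mem_image, Finset.mem_product, Finset.mem_range]
        exact ⟨(i, r), ⟨him, hr⟩, he⟩
      have n0 := hne 0 (by omega)
      have n1 := hne 1 (by omega)
      have n2 := hne 2 (by omega)
      by_cases hlt : p < i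
      · refine ⟨i+2, by omega, by omega, ?_⟩
        rw [insW_hi _ _ _ _ (by omega), insW_hi _ _ _ _ (by omega), insW_hi _ _ _ _ (by omega),
          insW_hi _ _ _ _ (by omega)]
        exact ⟨by rw [show i + 2 - 1 - 2 = i - 1 by omega]; exact c, d, e, f⟩
      · refine ⟨i, by omega, by omega, ?_⟩
        rw [insW_lo _ _ _ _ (by omega), insW_lo _ _ _ _ (by omega), insW_lo _ _ _ _ (by omega),
          insW_lo _ _ _ _ (by omega)]
        exact ⟨c, d, e, f⟩

lemma delW_cases (w : ℕ → ℕ) (p i : ℕ) : (i < p ∧ delW w p i = w i) ∨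
    (p ≤ i ∧ delW w p i = w (i+2)) := by
  rcases Nat.lt_or_ge i p with h | h
  · exact Or.inl ⟨h, delW_lo w p i h⟩
  · exact Or.inr ⟨h, delW_hi w p i h⟩

lemma AMS_del {n : ℕ} {M : Set ℕ} (h : M ∈ AMS (n+1)) :
    ∃ M' ∈ AMS n, ∀ m ∈ M, m ≠ n+1 → m ∈ M' := by
  obtain ⟨w, hw, rfl⟩ := h
  have hb := hw.2.1
  have hc := hw.2.2
  obtain ⟨p, q, hp, hpq, hq, hwp, hwq, hall⟩ := stirling_two hw (n+1) (by omega) le_rfl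
  have hqp : q = p + 1 := by
    by_contra hne
    have h1 := hc p (p+1) q hp (by omega) (by omega) hq (by omega)
    have h2 := hb (p+1) (by omega) (by omega)
    omega
  subst hqp
  refine ⟨_, ⟨delW w p, ⟨?_, ?_, ?_⟩, rfl⟩, ?_⟩
  · intro k h1 h2
    apply two_card
    obtain ⟨a, b, ha, hab, hb2, hwa, hwb, hall2⟩ := stirling_two hw k h1 (by omega)
    have sh : ∀ c, w c = k → ∃ c', (c < p ∧ c' = c ∨ p + 2 ≤ c ∧ c = c' + 2) ∧
        delW w p c' = w c := by
      intro c hck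
      have n1 : c ≠ p := by rintro rfl; omega
      have n2 : c ≠ p + 1 := by rintro rfl; omega
      rcases Nat.lt_or_ge c p with hc | hc
      · exact ⟨c, by omega, delW_lo _ _ _ hc⟩
      · refine ⟨c-2, by omega, ?_⟩
        rw [delW_hi _ _ _ (by omega)]
        congr 1; omega
    obtain ⟨a', ha1, ha2⟩ := sh a hwa
    obtain ⟨b', hb1, hb3⟩ := sh b hwb
    refine ⟨a', b', by omega, by omega, by omega, by omega, by omega, ?_⟩
    intro i hi1 hi2 hi3
    rcases delW_cases w p i with ⟨h4, h5⟩ | ⟨h4, h5⟩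
    · have := hall2 i hi1 (by omega) (by omega); omega
    · have := hall2 (i+2) (by omega) (by omega) (by omega); omega
  · intro i hi1 hi2
    rcases delW_cases w p i with ⟨h4, h5⟩ | ⟨h4, h5⟩
    · have := hb i hi1 (by omega)
      have := hall i hi1 (by omega)
      omega
    · have := hb (i+2) (by omega) (by omega)
      have := hall (i+2) (by omega) (by omega)
      omega
  · intro i j l hi hij hjl hl heq
    rcases delW_cases w p i with ⟨i4, i5⟩ | ⟨i4, i5⟩ <;>
    rcases delW_cases w p j with ⟨j4, j5⟩ | ⟨j4, j5⟩ <;>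
    rcases delW_cases w p l with ⟨l4, l5⟩ | ⟨l4, l5⟩ <;>
    first
    | omega
    | (have := hc i j l hi hij hjl (by omega) (by omega); omega)
    | (have := hc i j (l+2) hi hij (by omega) (by omega) (by omega); omega)
    | (have := hc i (j+2) (l+2) hi (by omega) (by omega) (by omega) (by omega); omega)
    | (have := hc (i+2) (j+2) (l+2) (by omega) (by omega) (by omega) (by omega) (by omega); omega)
  · rintro m ⟨i, a, b, c, d, e, f⟩ hm
    have hi := (hb i (by omega) (by omega)).2
    have n1 : p ≠ i := by rintro rfl; omega
    have n2 : p ≠ i + 1 := by rintro rfl; omega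
    have n3 : p ≠ i + 2 := by rintro rfl; omega
    have n4 : p ≠ i - 1 := by rintro rfl; omega
    have n5 : p + 1 ≠ i - 1 := by intro he; rw [← he] at c; omega
    by_cases hlt : p < i
    · refine ⟨i-2, by omega, by omega, ?_⟩
      rw [delW_hi _ _ _ (by omega), delW_hi _ _ _ (by omega), delW_hi _ _ _ (by omega),
        delW_hi _ _ _ (by omega)]
      rw [show i - 2 - 1 + 2 = i - 1 by omega, show i - 2 + 2 = i by omega,
        show i - 2 + 1 + 2 = i + 1 by omega]
      exact ⟨c, d, e, f⟩
    · refine ⟨i, by omega, by omega, ?_⟩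
      rw [delW_lo _ _ _ (by omega), delW_lo _ _ _ (by omega), delW_lo _ _ _ (by omega),
        delW_lo _ _ _ (by omega)]
      exact ⟨c, d, e, f⟩

lemma AMS_sub {n : ℕ} {M : Set ℕ} (h : M ∈ AMS n) : M ⊆ Set.Icc 1 n := by
  obtain ⟨w, hw, rfl⟩ := h
  rintro m ⟨i, a, b, c, d, e, f⟩
  have := hw.2.1 i (by omega) (by omega)
  rw [f] at this
  exact this

lemma AMS_bound {n : ℕ} (hn : 1 ≤ n) {M : Set ℕ} (h : M ∈ AMS n) : 3 * M.ncard + 1 ≤ 2 * n := by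
  obtain ⟨w, hw, rfl⟩ := h
  exact mesa_bound hn hw

lemma AMS_nec {n : ℕ} : ∀ {M : Set ℕ}, M ∈ AMS n → ∀ t, 1 ≤ t → t ≤ n →
    3 * (M ∩ Set.Icc 1 t).ncard + 1 ≤ 2 * t := by
  induction n with
  | zero => intro M _ t h1 h2; omega
  | succ n ih =>
    intro M hM t h1 h2
    rcases Nat.lt_or_ge n t with ht | ht
    · have : t = n + 1 := by omega
      subst this
      rw [Set.inter_eq_left.2 (AMS_sub hM)]
      exact AMS_bound (by omega) hM
    · obtain ⟨M', hM', hsub⟩ := AMS_del hM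
      have := ih hM' t h1 ht
      have hle : (M ∩ Set.Icc 1 t).ncard ≤ (M' ∩ Set.Icc 1 t).ncard := by
        apply Set.ncard_le_ncard
        · rintro m ⟨h3, h4⟩
          exact ⟨hsub m h3 (by have := h4.2; omega), h4⟩
        · exact (Set.finite_Icc 1 t).inter_of_right M'
      omega

lemma AMS_suf {n : ℕ} : ∀ {M : Set ℕ}, M ⊆ Set.Icc 1 n →
    (∀ t, 1 ≤ t → t ≤ n → 3 * (M ∩ Set.Icc 1 t).ncard + 1 ≤ 2 * t) → M ∈ AMS n := by
  induction n with
  | zero =>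
    intro M hM _
    have : M = ∅ := by
      apply Set.eq_empty_of_subset_empty
      simpa using hM
    subst this
    refine ⟨fun _ => 0, ⟨by intros; omega, by intros; omega, by intros; omega⟩, ?_⟩
    ext m
    simp [MesaSet]
  | succ n ih =>
    intro M hM ht
    by_cases hn : n + 1 ∈ M
    · have hM' : M \ {n+1} ∈ AMS n := by
        apply ih
        · rintro m ⟨h1, h2⟩
          have := hM h1
          simp only [Set.mem_singleton_iff] at h2
          exact ⟨this.1, by have := this.2; omega⟩
        · intro t h1 h2
          have := ht t h1 (by omega)
          have hle : ((M \ {n+1}) ∩ Set.Icc 1 t).ncard ≤ (M ∩ Set.Icc 1 t).ncard :=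
            Set.ncard_le_ncard (Set.inter_subset_inter_left _ Set.sdiff_subset)
              ((Set.finite_Icc 1 t).inter_of_right M)
          omega
      have h1 := ht (n+1) (by omega) le_rfl
      rw [Set.inter_eq_left.2 hM] at h1
      have h2 := Set.ncard_sdiff_singleton_add_one hn ((Set.finite_Icc 1 (n+1)).subset hM)
      have := AMS_ins hM' (by omega)
      rwa [Set.insert_sdiff_singleton, Set.insert_eq_of_mem hn] at this
    · apply AMS_up
      apply ih
      · intro m h1
        have := hM h1
        have hne : m ≠ n + 1 := by rintro rfl; exact hn h1
        exact ⟨this.1, by have := this.2; omega⟩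
      · intro t h1 h2
        exact ht t h1 (by omega)

/-- deleting the maximum from an admissible set -/
lemma AMS_diff {n : ℕ} {M : Set ℕ} (h : M ∈ AMS (n+1)) : M \ {n+1} ∈ AMS n := by
  apply AMS_suf
  · rintro m ⟨h1, h2⟩
    have := AMS_sub h h1
    simp only [Set.mem_singleton_iff] at h2
    exact ⟨this.1, by have := this.2; omega⟩
  · intro t h1 h2
    have := AMS_nec h t h1 (by omega)
    have hle : ((M \ {n+1}) ∩ Set.Icc 1 t).ncard ≤ (M ∩ Set.Icc 1 t).ncard :=
      Set.ncard_le_ncard (Set.inter_subset_inter_left _ Set.sdiff_subset)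
        ((Set.finite_Icc 1 t).inter_of_right M)
    omega

lemma AMS_notMem {n : ℕ} {M : Set ℕ} (h : M ∈ AMS n) : n + 1 ∉ M := by
  intro h1
  have := (AMS_sub h h1).2
  omega

lemma AMS_fin (n : ℕ) : (AMS n).Finite :=
  (Set.finite_Icc 1 n).finite_subsets.subset (fun _ hM => AMS_sub hM)

lemma AMS_rec (n : ℕ) : AMS (n+1) =
    AMS n ∪ (insert (n+1)) '' {M ∈ AMS n | 3 * M.ncard + 2 ≤ 2 * n} := by
  ext M
  constructor
  · intro h
    by_cases hn : n + 1 ∈ M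
    · right
      refine ⟨M \ {n+1}, ⟨AMS_diff h, ?_⟩, by
        rw [Set.insert_sdiff_singleton, Set.insert_eq_of_mem hn]⟩
      have h1 := AMS_bound (by omega) h
      have h2 := Set.ncard_sdiff_singleton_add_one hn ((Set.finite_Icc 1 (n+1)).subset (AMS_sub h))
      omega
    · left
      have := AMS_diff h
      rwa [Set.sdiff_singleton_eq_self hn] at this
  · rintro (h | ⟨M', ⟨h1, h2⟩, rfl⟩)
    · exact AMS_up h
    · exact AMS_ins h1 h2

theorem AMS_card_3k (k : ℕ) (hk : 1 ≤ k) :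
    (AMS (3*k)).ncard =
      2 * (AMS (3*k-1)).ncard - {M ∈ AMS (3*k-1) | M.ncard = 2*k - 1}.ncard := by
  obtain ⟨n, hn⟩ : ∃ n, n + 1 = 3 * k := ⟨3*k-1, by omega⟩
  rw [← hn, Nat.add_sub_cancel, AMS_rec n]
  have hfin := AMS_fin n
  have hA : {M ∈ AMS n | 3 * M.ncard + 2 ≤ 2 * n}.Finite := hfin.subset (fun _ h => h.1)
  rw [Set.ncard_union_eq _ hfin (hA.image _), Set.ncard_image_of_injOn]
  · have hsplit : AMS n = {M ∈ AMS n | 3 * M.ncard + 2 ≤ 2 * n} ∪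
        {M ∈ AMS n | M.ncard = 2*k - 1} := by
      ext M
      constructor
      · intro h
        have := AMS_bound (by omega) h
        by_cases hc : M.ncard = 2*k-1
        · exact Or.inr ⟨h, hc⟩
        · exact Or.inl ⟨h, by omega⟩
      · rintro (h | h)
        · exact h.1
        · exact h.1
    have hd : Disjoint {M ∈ AMS n | 3 * M.ncard + 2 ≤ 2 * n} {M ∈ AMS n | M.ncard = 2*k - 1} := by
      rw [Set.disjoint_left]
      rintro M ⟨_, h1⟩ ⟨_, h2⟩
      omega
    have := Set.ncard_union_eq hd hA (hfin.subset (fun _ h => h.1))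
    rw [← hsplit] at this
    omega
  · intro M hM M' hM' heq
    have h1 := AMS_notMem hM.1
    have h2 := AMS_notMem hM'.1
    have h3 : insert (n+1) M \ {n+1} = insert (n+1) M' \ {n+1} := by
      rw [heq]
    rwa [Set.insert_sdiff_self_of_notMem h1, Set.insert_sdiff_self_of_notMem h2] at h3
  · rw [Set.disjoint_left]
    rintro M hM ⟨M', _, rfl⟩
    exact AMS_notMem hM (Set.mem_insert _ _)
end

section
/- Writing n = 3k + r with r ∈ {0,1,2} and k ≥ 0, the number of admissible mesa sets of Stirling permutations of order n equals 2^{n−1} − Σ_{i=0}^{k−1} 2^{3i+r} C_{2(k−i)−1, k−i}, where C_{m,ℓ} = (1/ℓ)·binom(ℓ+m−1, m). -/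
/-! ### Numerics: first passage counts -/

/-- Paths with steps `-1`, `+2` from height `h` hitting `0` first at time `t`. -/
def fpc : ℕ → ℕ → ℕ
  | 0, 0 => 1
  | 0, _ + 1 => 0
  | _ + 1, 0 => 0
  | h + 1, t + 1 => fpc h t + fpc (h + 3) t

/-- Paths with `n` steps from height `h` staying positive. -/
def gpc : ℕ → ℕ → ℕ
  | 0, _ => 0
  | _ + 1, 0 => 1
  | h + 1, n + 1 => gpc (h + 3) n + gpc h n

lemma fpc_lt (t : ℕ) : ∀ h, t < h → fpc h t = 0 := by
  induction t with
  | zero => intro h hh; obtain ⟨h, rfl⟩ : ∃ k, h = k + 1 := ⟨h - 1, by omega⟩; simp [fpc]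
  | succ t ih =>
    intro h hh
    obtain ⟨h, rfl⟩ : ∃ k, h = k + 1 := ⟨h - 1, by omega⟩
    simp [fpc, ih h (by omega), ih (h + 3) (by omega)]

lemma fpc_mod (t : ℕ) : ∀ h, t % 3 ≠ h % 3 → fpc h t = 0 := by
  induction t with
  | zero => intro h hh; obtain ⟨h, rfl⟩ : ∃ k, h = k + 1 := ⟨h - 1, by omega⟩; simp [fpc]
  | succ t ih =>
    intro h hh
    cases h with
    | zero => simp [fpc]
    | succ h => simp [fpc, ih h (by omega), ih (h + 3) (by omega)]

lemma fpc_closed (t : ℕ) : ∀ h u, t = h + 3 * u → t * fpc h t = h * t.choose u := by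
  induction t with
  | zero => intro h u hh; obtain rfl : h = 0 := by omega
            simp
  | succ t ih =>
    intro h u hh
    cases h with
    | zero => simp [fpc]
    | succ h =>
      have h1 := ih h u (by omega)
      rcases Nat.eq_zero_or_pos t with h0 | h0
      · obtain rfl : u = 0 := by omega
        obtain rfl : h = 0 := by omega
        subst h0
        simp [fpc]
      · apply Nat.eq_of_mul_eq_mul_left h0
        cases u with
        | zero =>
          have h2 := fpc_lt t (h + 3) (by omega)
          simp only [fpc, h2, Nat.choose_zero_right] at *
          obtain rfl : t = h := by omega
          nlinarith
        | succ u =>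
          have h2 := ih (h + 3) u (by omega)
          have h3 := Nat.choose_succ_right_eq t u
          have h4 : t - u = h + 2 * u + 3 := by omega
          rw [h4] at h3
          rw [fpc, Nat.choose_succ_succ]
          have ht : t = h + 3 * u + 3 := by omega
          generalize t.choose u = A at *
          generalize t.choose (u + 1) = B at *
          generalize fpc h t = F at *
          generalize fpc (h + 3) t = F' at *
          have : t * ((t + 1) * (F + F')) = (t + 1) * (t * F + t * F') := by ring
          rw [this, h1, h2]
          clear ih h1 h2 this hh h4
          subst ht
          zify at h3 ⊢
          linear_combination (-3) * h3

lemma fpc_two (u : ℕ) : fpc 2 (3 * u + 2) = (3 * u + 1).choose (2 * u + 1) / (u + 1) := by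
  have h1 := fpc_closed (3 * u + 2) 2 u (by omega)
  have h2 := Nat.add_one_mul_choose_eq (3 * u + 1) (2 * u + 1)
  have h3 : (3 * u + 2).choose (2 * u + 2) = (3 * u + 2).choose u := by
    rw [← Nat.choose_symm_of_eq_add]; omega
  have h2' : (3 * u + 2) * (3 * u + 1).choose (2 * u + 1) = (3 * u + 2).choose u * (2 * u + 2) := by
    rw [← h3]; exact h2
  symm
  apply Nat.div_eq_of_eq_mul_right (by omega)
  apply Nat.eq_of_mul_eq_mul_left (show 0 < 3 * u + 2 by omega)
  rw [h2']
  have : (3 * u + 2) * ((u + 1) * fpc 2 (3 * u + 2)) = (u + 1) * ((3 * u + 2) * fpc 2 (3 * u + 2)) := by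
    ring
  rw [this, h1]; ring

lemma gpc_total (n : ℕ) : ∀ h, gpc h n + ∑ t ∈ Finset.range (n + 1), fpc h t * 2 ^ (n - t) = 2 ^ n := by
  induction n with
  | zero => intro h; cases h <;> simp [gpc, fpc]
  | succ n ih =>
    intro h
    rw [Finset.sum_range_succ']
    cases h with
    | zero => simp [gpc, fpc]
    | succ h =>
      have h1 := ih h
      have h2 := ih (h + 3)
      simp only [gpc, fpc, Nat.add_sub_add_right, add_mul, Finset.sum_add_distrib, pow_succ]
      simp only [Nat.zero_mul]
      omega

lemma sum_three (F : ℕ → ℕ) (h : ∀ t, t % 3 ≠ 2 → F t = 0) (k : ℕ) :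
    ∑ t ∈ Finset.range (3 * k), F t = ∑ j ∈ Finset.range k, F (3 * j + 2) := by
  induction k with
  | zero => simp
  | succ k ih =>
    rw [show 3 * (k + 1) = 3 * k + 1 + 1 + 1 by ring, Finset.sum_range_succ, Finset.sum_range_succ,
      Finset.sum_range_succ, Finset.sum_range_succ, ih, h (3 * k) (by omega),
      h (3 * k + 1) (by omega), Nat.add_zero, Nat.add_zero]

lemma gpc_formula (k r : ℕ) (hr : r < 3) :
    gpc 2 (3 * k + r - 1) = 2^(3*k + r - 1) -
        ∑ i ∈ Finset.range k,
          2^(3*i + r) * ((3*(k-i) - 2).choose (2*(k-i) - 1) / (k - i)) := by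
  rcases Nat.eq_zero_or_pos (3 * k + r) with h0 | h0
  · obtain rfl : k = 0 := by omega
    obtain rfl : r = 0 := by omega
    simp [gpc]
  have h1 := gpc_total (3 * k + r - 1) 2
  rw [show 3 * k + r - 1 + 1 = 3 * k + r by omega] at h1
  have h2 : ∑ t ∈ Finset.range (3 * k + r), fpc 2 t * 2 ^ (3 * k + r - 1 - t)
      = ∑ t ∈ Finset.range (3 * k), fpc 2 t * 2 ^ (3 * k + r - 1 - t) := by
    rw [Finset.sum_range_add]
    simp only [Nat.add_eq_left]
    apply Finset.sum_eq_zero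
    intro x hx
    rw [Finset.mem_range] at hx
    rw [fpc_mod _ _ (by omega), Nat.zero_mul]
  have h3 := sum_three (fun t => fpc 2 t * 2 ^ (3 * k + r - 1 - t))
    (fun t ht => by rw [fpc_mod _ _ (by omega), Nat.zero_mul]) k
  have h4 : ∑ i ∈ Finset.range k,
          2^(3*i + r) * ((3*(k-i) - 2).choose (2*(k-i) - 1) / (k - i))
      = ∑ j ∈ Finset.range k, fpc 2 (3 * j + 2) * 2 ^ (3 * k + r - 1 - (3 * j + 2)) := by
    rw [← Finset.sum_range_reflect]
    apply Finset.sum_congr rfl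
    intro j hj
    rw [Finset.mem_range] at hj
    rw [fpc_two, Nat.mul_comm, show k - (k - 1 - j) = j + 1 by omega,
      show 3 * (j + 1) - 2 = 3 * j + 1 by omega, show 2 * (j + 1) - 1 = 2 * j + 1 by omega,
      show 3 * k + r - 1 - (3 * j + 2) = 3 * (k - 1 - j) + r by omega]
  rw [h4]
  rw [h2, h3] at h1
  omega

/-! ### Counting the sets -/

/-- Subsets of `[s, s+n)` whose path from height `h` stays positive. -/
def goodSets : ℕ → ℕ → ℕ → Finset (Finset ℕ)
  | 0, _, _ => ∅
  | _ + 1, _, 0 => {∅}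
  | h + 1, s, n + 1 => goodSets (h + 3) (s + 1) n ∪ (goodSets h (s + 1) n).image (insert s)

lemma goodSets_mem (n : ℕ) : ∀ h s M, M ∈ goodSets h s n ↔
    M ⊆ Finset.Ico s (s + n) ∧ ∀ m ≤ n, 3 * (M ∩ Finset.Ico s (s + m)).card < h + 2 * m := by
  induction n with
  | zero =>
    intro h s M
    cases h with
    | zero => simp [goodSets]
    | succ h => simp [goodSets]
  | succ n ih =>
    intro h s M
    cases h with
    | zero =>
      simp only [goodSets, Finset.notMem_empty, false_iff, not_and]
      intro _ h
      have := h 0 (by omega)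
      omega
    | succ h =>
      simp only [goodSets, Finset.mem_union, Finset.mem_image, ih]
      have key : ∀ m, Finset.Ico s (s + (m + 1)) = insert s (Finset.Ico (s + 1) (s + 1 + m)) := by
        intro m; ext x; simp; omega
      constructor
      · rintro (⟨h1, h2⟩ | ⟨M', ⟨h1, h2⟩, rfl⟩)
        · refine ⟨?_, ?_⟩
          · rw [key]; exact h1.trans (Finset.subset_insert _ _)
          · intro m hm
            cases m with
            | zero => simp
            | succ m =>
              have hs : s ∉ M := fun hs => by have := h1 hs; simp at this
              rw [key, Finset.inter_insert_of_notMem hs]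
              have := h2 m (by omega)
              omega
        · refine ⟨?_, ?_⟩
          · rw [key]; exact Finset.insert_subset_insert _ h1
          · intro m hm
            cases m with
            | zero => simp
            | succ m =>
              rw [key, ← Finset.insert_inter_distrib]
              have := h2 m (by omega)
              have h3 := Finset.card_insert_le s (M' ∩ Finset.Ico (s + 1) (s + 1 + m))
              omega
      · rintro ⟨h1, h2⟩
        by_cases hs : s ∈ M
        · right
          refine ⟨M.erase s, ⟨?_, ?_⟩, Finset.insert_erase hs⟩
          · intro x hx
            rw [Finset.mem_erase] at hx
            have := h1 hx.2
            simp at this ⊢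
            omega
          · intro m hm
            have := h2 (m + 1) (by omega)
            rw [key] at this
            have h4 : M ∩ insert s (Finset.Ico (s + 1) (s + 1 + m)) =
                insert s (M.erase s ∩ Finset.Ico (s + 1) (s + 1 + m)) := by
              ext x
              simp only [Finset.mem_inter, Finset.mem_insert, Finset.mem_erase]
              by_cases hx : x = s <;> simp [hx, hs]
            rw [h4, Finset.card_insert_of_notMem (by simp)] at this
            omega
        · left
          refine ⟨?_, ?_⟩
          · intro x hx
            have := h1 hx
            have : x ≠ s := fun e => hs (e ▸ hx)
            simp at *
            omega
          · intro m hm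
            have := h2 (m + 1) (by omega)
            rw [key, Finset.inter_insert_of_notMem hs] at this
            omega

lemma goodSets_card (n : ℕ) : ∀ h s, (goodSets h s n).card = gpc h n := by
  induction n with
  | zero => intro h s; cases h <;> simp [goodSets, gpc]
  | succ n ih =>
    intro h s
    cases h with
    | zero => simp [goodSets, gpc]
    | succ h =>
      have hn : ∀ h', ∀ M ∈ goodSets h' (s + 1) n, s ∉ M := by
        intro h' M hM hs
        have := ((goodSets_mem _ _ _ _).1 hM).1 hs
        simp at this
      rw [goodSets, gpc, Finset.card_union_of_disjoint, ih, Finset.card_image_of_injOn, ih]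
      · intro A hA B hB hAB
        have h1 := hn _ A hA
        have h2 := hn _ B hB
        try dsimp only at hAB
        rw [← Finset.erase_insert h1, hAB, Finset.erase_insert h2]
      · rw [Finset.disjoint_left]
        intro A hA hB
        obtain ⟨B, hB, rfl⟩ := Finset.mem_image.1 hB
        exact hn _ _ hA (Finset.mem_insert_self _ _)

/-! ### Necessity -/

lemma mesa_bound_s18 (n : ℕ) (w : ℕ → ℕ) (hw : IsStirling n w) (m : ℕ) (hm : 1 ≤ m) (hmn : m ≤ n)
    (M : Finset ℕ) (hM : ∀ a ∈ M, a ∈ MesaSet n w ∧ a ≤ m) : 3 * M.card < 2 * m := by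
  obtain ⟨hw1, hw2, -⟩ := hw
  rcases M.eq_empty_or_nonempty with rfl | hne
  · simp; omega
  have hex : ∀ a : ℕ, ∃ i, a ∈ M → (2 ≤ i ∧ i + 2 ≤ 2*n ∧ w (i-1) < w i ∧ w i = w (i+1) ∧
      w (i+2) < w i ∧ w i = a) := by
    intro a
    by_cases ha : a ∈ M
    · obtain ⟨i, hi⟩ := (hM a ha).1
      exact ⟨i, fun _ => hi⟩
    · exact ⟨0, fun h => absurd h ha⟩
  choose q hq using hex
  set T := (Finset.Icc 1 (2 * n)).filter (fun i => w i ∈ Finset.Icc 1 m) with hT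
  have hTc : T.card = 2 * m := by
    rw [Finset.card_eq_sum_card_fiberwise (f := w) (t := Finset.Icc 1 m)
      (fun x hx => by
        have hx' : x ∈ T := hx
        rw [hT, Finset.mem_filter] at hx'; exact hx'.2)]
    rw [Finset.sum_congr rfl (g := fun _ => 2)]
    · simp; ring
    · intro k hk
      rw [Finset.mem_Icc] at hk
      rw [← hw1 k hk.1 (by omega)]
      congr 1
      ext x
      simp only [hT, Finset.mem_filter, Finset.mem_Icc]
      constructor
      · rintro ⟨⟨h1, _⟩, h3⟩; exact ⟨h1, h3⟩
      · rintro ⟨h1, h3⟩; exact ⟨⟨h1, by omega⟩, h3⟩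
  obtain ⟨b, hb, hbmin⟩ := Finset.exists_min_image M q hne
  set I := (M ×ˢ Finset.range 3).image (fun x => q x.1 + x.2) with hI
  have hIc : I.card = M.card * 3 := by
    rw [hI, Finset.card_image_of_injOn, Finset.card_product, Finset.card_range]
    rintro ⟨a, d⟩ h1 ⟨c, e⟩ h2 h3
    simp only [Finset.coe_product, Set.mem_prod, Finset.mem_coe, Finset.mem_range] at h1 h2 h3
    have qa := hq a h1.1
    have qc := hq c h2.1
    generalize q a = x at *
    generalize q c = y at *
    have hxy : x = y := by
      rcases (by omega : x = y ∨ x = y + 1 ∨ x = y + 2 ∨ y = x + 1 ∨ y = x + 2) with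
        h | h | h | h | h
      · exact h
      all_goals
        subst h
        simp only [Nat.add_sub_cancel, show ∀ z, z + 2 - 1 = z + 1 from fun _ => rfl] at qa qc
        omega
    subst hxy
    simp only [Prod.mk.injEq]
    omega
  have hqb := hq b hb
  have hnot : q b - 1 ∉ I := by
    rw [hI, Finset.mem_image]
    rintro ⟨⟨a, d⟩, h1, h2⟩
    rw [Finset.mem_product] at h1
    have := hbmin a h1.1
    try dsimp only at h2
    omega
  have hsub : insert (q b - 1) I ⊆ T := by
    intro x hx
    rw [hT, Finset.mem_filter, Finset.mem_Icc, Finset.mem_Icc]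
    suffices h : 1 ≤ x ∧ x ≤ 2 * n ∧ w x ≤ m from ⟨⟨h.1, h.2.1⟩, (hw2 x h.1 h.2.1).1, h.2.2⟩
    rcases Finset.mem_insert.1 hx with rfl | hx
    · have := (hM b hb).2
      omega
    · rw [hI, Finset.mem_image] at hx
      obtain ⟨⟨a, d⟩, h1, rfl⟩ := hx
      rw [Finset.mem_product, Finset.mem_range] at h1
      try dsimp only at h1 ⊢
      have h3 := (hM a h1.1).2
      have h4 := hq a h1.1
      rcases (by omega : d = 0 ∨ d = 1 ∨ d = 2) with rfl | rfl | rfl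
      · rw [Nat.add_zero]; omega
      · omega
      · omega
  have := Finset.card_le_card hsub
  rw [Finset.card_insert_of_notMem hnot] at this
  omega

/-! ### Sufficiency -/

/-- Insert the pair `N N` after position `p`. -/
def insPair (N p : ℕ) (w : ℕ → ℕ) (i : ℕ) : ℕ :=
  if i ≤ p then w i else if i ≤ p + 2 then N else w (i - 2)

lemma insPair_low {N p i : ℕ} {w : ℕ → ℕ} (h : i ≤ p) : insPair N p w i = w i := by
  simp [insPair, h]

lemma insPair_mid {N p i : ℕ} {w : ℕ → ℕ} (h : p < i) (h' : i ≤ p + 2) : insPair N p w i = N := by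
  simp [insPair, h', Nat.not_le.2 h]

lemma insPair_high {N p i : ℕ} {w : ℕ → ℕ} (h : p + 2 < i) : insPair N p w i = w (i - 2) := by
  simp [insPair, Nat.not_le.2 h, Nat.not_le.2 (show p < i by omega)]

lemma insPair_stirling (n p : ℕ) (w : ℕ → ℕ) (hw : IsStirling n w) (hp : p ≤ 2 * n) :
    IsStirling (n + 1) (insPair (n + 1) p w) := by
  obtain ⟨h1, h2, h3⟩ := hw
  refine ⟨?_, ?_, ?_⟩
  · intro k hk hkn
    rcases (by omega : k ≤ n ∨ k = n + 1) with hk' | rfl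
    · refine Eq.trans ?_ (h1 k hk hk')
      rw [← Finset.card_image_of_injective ((Finset.Icc 1 (2*n)).filter (fun i => w i = k))
        (f := fun i => if i ≤ p then i else i + 2)]
      · congr 1
        ext x
        simp only [Finset.mem_filter, Finset.mem_Icc, Finset.mem_image]
        constructor
        · rintro ⟨hx, hxk⟩
          rcases (by omega : x ≤ p ∨ (p < x ∧ x ≤ p + 2) ∨ p + 2 < x) with h | h | h
          · rw [insPair_low h] at hxk
            exact ⟨x, ⟨⟨by omega, by omega⟩, hxk⟩, by simp [h]⟩
          · rw [insPair_mid h.1 h.2] at hxk; omega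
          · rw [insPair_high h] at hxk
            refine ⟨x - 2, ⟨⟨by omega, by omega⟩, hxk⟩, ?_⟩
            rw [if_neg (by omega)]; omega
        · rintro ⟨y, ⟨hy, hyk⟩, rfl⟩
          by_cases h : y ≤ p
          · rw [if_pos h, insPair_low h]; exact ⟨by omega, hyk⟩
          · rw [if_neg h, insPair_high (by omega)]; exact ⟨by omega, hyk⟩
      · intro x y hxy
        try dsimp only at hxy
        split_ifs at hxy <;> omega
    · have : (Finset.Icc 1 (2 * (n + 1))).filter (fun i => insPair (n + 1) p w i = n + 1)
          = {p + 1, p + 2} := by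
        ext x
        simp only [Finset.mem_filter, Finset.mem_Icc, Finset.mem_insert, Finset.mem_singleton]
        constructor
        · rintro ⟨hx, hxk⟩
          rcases (by omega : x ≤ p ∨ (p < x ∧ x ≤ p + 2) ∨ p + 2 < x) with h | h | h
          · rw [insPair_low h] at hxk
            have := h2 x (by omega) (by omega)
            omega
          · omega
          · rw [insPair_high h] at hxk
            have := h2 (x - 2) (by omega) (by omega)
            omega
        · intro hx
          exact ⟨by omega, insPair_mid (by omega) (by omega)⟩
      rw [this, Finset.card_pair (by omega)]
  · intro i hi hin
    rcases (by omega : i ≤ p ∨ (p < i ∧ i ≤ p + 2) ∨ p + 2 < i) with h | h | h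
    · rw [insPair_low h]
      have := h2 i (by omega) (by omega)
      omega
    · rw [insPair_mid h.1 h.2]; omega
    · rw [insPair_high h]
      have := h2 (i - 2) (by omega) (by omega)
      omega
  · intro i j l hi hij hjl hl hil
    rcases (by omega : i ≤ p ∨ (p < i ∧ i ≤ p + 2) ∨ p + 2 < i) with h | h | h <;>
    rcases (by omega : l ≤ p ∨ (p < l ∧ l ≤ p + 2) ∨ p + 2 < l) with h' | h' | h' <;>
    rcases (by omega : j ≤ p ∨ (p < j ∧ j ≤ p + 2) ∨ p + 2 < j) with h'' | h'' | h'' <;>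
    try omega
    all_goals
      simp only [insPair_low, insPair_mid, insPair_high, h, h', h''] at hil ⊢
    all_goals first
      | exact h3 _ _ _ (by omega) (by omega) (by omega) (by omega) hil
      | (have := h2 i (by omega) (by omega); omega)
      | (have := h2 (i - 2) (by omega) (by omega); omega)
      | (have := h2 (l - 2) (by omega) (by omega); omega)

lemma insPair_mesa (n p : ℕ) (w : ℕ → ℕ) (hw : IsStirling n w) (hp : p ≤ 2 * n) (hp1 : 1 ≤ p ∨ n = 0)
    (hgood : ∀ i, 2 ≤ i → i + 2 ≤ 2*n → w (i-1) < w i → w i = w (i+1) → w (i+2) < w i →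
      p + 1 < i ∨ i + 1 < p) (a : ℕ) :
    a ∈ MesaSet (n + 1) (insPair (n + 1) p w) ↔ a ∈ MesaSet n w ∨ (a = n + 1 ∧ p < 2 * n) := by
  obtain ⟨h1, h2, h3⟩ := hw
  constructor
  · rintro ⟨i, hi, hin, ha, hb, hc, rfl⟩
    rcases (by omega : i + 2 ≤ p ∨ i + 1 = p ∨ i = p ∨ i = p + 1 ∨ i = p + 2 ∨ i = p + 3 ∨ p + 4 ≤ i)
      with h | h | h | h | h | h | h
    · left
      rw [insPair_low (by omega), insPair_low (by omega)] at ha hb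
      rw [insPair_low (by omega), insPair_low (by omega)] at hc
      exact ⟨i, hi, by omega, ha, hb, hc, (insPair_low (by omega)).symm⟩
    · exfalso
      rw [insPair_mid (by omega) (by omega), insPair_low (by omega)] at hc
      have := h2 i (by omega) (by omega)
      omega
    · exfalso
      rw [insPair_low (by omega), insPair_mid (by omega) (by omega)] at hb
      have := h2 i (by omega) (by omega)
      omega
    · right
      exact ⟨insPair_mid (by omega) (by omega), by omega⟩
    · exfalso
      rw [insPair_mid (by omega) (by omega), insPair_mid (by omega) (by omega)] at ha
      omega
    · exfalso
      rw [insPair_mid (by omega) (by omega), insPair_high (by omega)] at ha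
      have := h2 (i - 2) (by omega) (by omega)
      omega
    · left
      rw [insPair_high (by omega), insPair_high (by omega)] at ha hb
      rw [insPair_high (by omega), insPair_high (by omega)] at hc
      refine ⟨i - 2, by omega, by omega, ?_, ?_, ?_, (insPair_high (by omega)).symm⟩
      · rwa [show i - 2 - 1 = i - 1 - 2 by omega]
      · rwa [show i - 2 + 1 = i + 1 - 2 by omega]
      · rwa [show i - 2 + 2 = i + 2 - 2 by omega]
  · rintro (⟨i, hi, hin, ha, hb, hc, rfl⟩ | ⟨rfl, hp2⟩)
    · rcases hgood i hi hin ha hb hc with h | h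
      · refine ⟨i + 2, by omega, by omega, ?_, ?_, ?_, ?_⟩
        · rw [insPair_high (by omega), insPair_high (by omega)]
          rwa [show i + 2 - 1 - 2 = i - 1 by omega]
        · rw [insPair_high (by omega), insPair_high (by omega)]
          exact hb
        · rw [insPair_high (by omega), insPair_high (by omega)]
          exact hc
        · rw [insPair_high (by omega)]; rfl
      · refine ⟨i, by omega, by omega, ?_, ?_, ?_, ?_⟩
        · rw [insPair_low (by omega), insPair_low (by omega)]
          exact ha
        · rw [insPair_low (by omega), insPair_low (by omega)]
          exact hb
        · by_cases h' : i + 2 ≤ p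
          · rw [insPair_low (by omega), insPair_low (by omega)]
            exact hc
          · omega
        · rw [insPair_low (by omega)]
    · refine ⟨p + 1, by omega, by omega, ?_, ?_, ?_, insPair_mid (by omega) (by omega)⟩
      · rw [insPair_low (by omega), insPair_mid (by omega) (by omega)]
        have := h2 p (by omega) (by omega)
        simp only [Nat.add_sub_cancel]
        omega
      · rw [insPair_mid (by omega) (by omega), insPair_mid (by omega) (by omega)]
      · rw [insPair_high (by omega), insPair_mid (by omega) (by omega)]
        have := h2 (p + 1) (by omega) (by omega)
        rw [show p + 1 + 2 - 2 = p + 1 by omega]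
        omega

lemma mesa_exists (n : ℕ) : ∀ M : Finset ℕ, M ⊆ Finset.Icc 1 n →
    (∀ m, 1 ≤ m → m ≤ n → 3 * (M ∩ Finset.Icc 1 m).card < 2 * m) →
    ∃ w, IsStirling n w ∧ MesaSet n w = (M : Set ℕ) := by
  induction n with
  | zero =>
    intro M hM _
    obtain rfl : M = ∅ := by simpa using hM
    refine ⟨fun _ => 0, ⟨?_, ?_, ?_⟩, ?_⟩
    · intros; omega
    · intros; omega
    · intros; omega
    · ext a
      simp only [MesaSet, Set.mem_ofPred_eq, Finset.coe_empty, Set.mem_empty_iff_false, iff_false]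
      rintro ⟨i, hi, hi2, _⟩
      omega
  | succ n ih =>
    intro M hM hc
    obtain ⟨w, hw, hwM⟩ := ih (M.erase (n + 1))
      (by
        intro x hx
        rw [Finset.mem_erase] at hx
        have := hM hx.2
        rw [Finset.mem_Icc] at *
        omega)
      (by
        intro m hm hmn
        refine lt_of_le_of_lt ?_ (hc m hm (by omega))
        gcongr
        exact Finset.erase_subset _ _)
    have hmem : ∀ a, a ∈ MesaSet n w ↔ a ≠ n + 1 ∧ a ∈ M := by
      intro a; rw [hwM, Finset.mem_coe, Finset.mem_erase]
    by_cases hn : n + 1 ∈ M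
    · have hall := hc (n + 1) (by omega) le_rfl
      rw [Finset.inter_eq_left.2 hM] at hall
      have hcard := Finset.card_erase_add_one hn
      have hex : ∀ a : ℕ, ∃ i, a ∈ MesaSet n w → (2 ≤ i ∧ i + 2 ≤ 2*n ∧ w (i-1) < w i ∧
          w i = w (i+1) ∧ w (i+2) < w i ∧ w i = a) := by
        intro a
        by_cases ha : a ∈ MesaSet n w
        · obtain ⟨i, hi⟩ := ha
          exact ⟨i, fun _ => hi⟩
        · exact ⟨0, fun h => absurd h ha⟩
      choose q hq using hex
      set B := ((M.erase (n + 1)) ×ˢ Finset.range 3).image (fun x => q x.1 - 1 + x.2) with hB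
      have hBc : B.card ≤ (M.erase (n + 1)).card * 3 := by
        refine Finset.card_image_le.trans ?_
        rw [Finset.card_product, Finset.card_range]
      obtain ⟨p, hp, hpB⟩ : ∃ p ∈ Finset.Icc 1 (2 * n - 1), p ∉ B := by
        apply Finset.exists_mem_notMem_of_card_lt_card
        rw [Nat.card_Icc]
        omega
      rw [Finset.mem_Icc] at hp
      refine ⟨insPair (n + 1) p w, insPair_stirling n p w hw (by omega), ?_⟩
      ext a
      rw [insPair_mesa n p w hw (by omega) (by omega), hmem, Finset.mem_coe]
      · by_cases ha : a = n + 1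
        · subst ha; simp [hn]; omega
        · simp [ha]
      · intro i hi hin h1 h2 h3
        by_contra hcon
        have hwi : w i ∈ MesaSet n w := ⟨i, hi, hin, h1, h2, h3, rfl⟩
        have hqi := hq _ hwi
        have hqe : q (w i) = i := by
          by_contra hne
          -- the value `w i` occurs at `i, i+1, q, q+1`, but only twice
          have hr := hw.2.1 i (by omega) (by omega)
          have hcnt := hw.1 (w i) hr.1 hr.2
          have hs : ({i, i + 1} ∪ {q (w i), q (w i) + 1} : Finset ℕ) ⊆
              (Finset.Icc 1 (2*n)).filter (fun j => w j = w i) := by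
            intro x hx
            simp only [Finset.mem_union, Finset.mem_insert, Finset.mem_singleton] at hx
            rw [Finset.mem_filter, Finset.mem_Icc]
            rcases hx with (rfl | rfl) | (rfl | rfl) <;> refine ⟨by omega, by omega⟩
          have h5 := Finset.eq_of_subset_of_card_le
            (Finset.subset_union_left.trans hs) (by rw [hcnt, Finset.card_pair (by omega)])
          have h6 := Finset.eq_of_subset_of_card_le
            (Finset.subset_union_right.trans hs) (by rw [hcnt, Finset.card_pair (by omega)])
          have h7 : i ∈ ({q (w i), q (w i) + 1} : Finset ℕ) := by
            rw [h6, ← h5]; simp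
          have h8 : q (w i) ∈ ({i, i + 1} : Finset ℕ) := by
            rw [h5, ← h6]; simp
          simp only [Finset.mem_insert, Finset.mem_singleton] at h7 h8
          omega
        apply hpB
        rw [hB, Finset.mem_image]
        refine ⟨(w i, p + 1 - i), ?_, ?_⟩
        · rw [Finset.mem_product, Finset.mem_range, Finset.mem_erase]
          refine ⟨(hmem _).1 hwi, ?_⟩
          try dsimp only
          omega
        · simp only [hqe]
          omega
    · refine ⟨insPair (n + 1) (2 * n) w, insPair_stirling n (2 * n) w hw le_rfl, ?_⟩
      ext a
      rw [insPair_mesa n (2 * n) w hw le_rfl (by omega), hmem, Finset.mem_coe]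
      · constructor
        · rintro (h | h)
          · exact h.2
          · omega
        · intro h
          exact Or.inl ⟨fun e => hn (e ▸ h), h⟩
      · intro i hi hin h1 h2 h3
        omega

lemma AMS_eq (n : ℕ) : AMS n = (fun M : Finset ℕ => (M : Set ℕ)) '' (goodSets 2 2 (n - 1) : Set (Finset ℕ)) := by
  classical
  ext S
  simp only [AMS, Set.mem_ofPred_eq, Set.mem_image, Finset.mem_coe]
  have e2 : ∀ M : Finset ℕ, 1 ∉ M → M ⊆ Finset.Icc 1 n → ∀ m, 1 ≤ m →
      M ∩ Finset.Ico 2 (2 + (m - 1)) = M ∩ Finset.Icc 1 m := by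
    intro M h1 hM m hm
    ext x
    simp only [Finset.mem_inter, Finset.mem_Ico, Finset.mem_Icc, and_congr_right_iff]
    intro hx
    have : x ≠ 1 := fun e => h1 (e ▸ hx)
    omega
  constructor
  · rintro ⟨w, hw, rfl⟩
    have hsub : ∀ a ∈ MesaSet n w, 2 ≤ a ∧ a ≤ n := by
      rintro a ⟨i, hi, hin, h1, h2, h3, rfl⟩
      have := hw.2.1 i (by omega) (by omega)
      have := hw.2.1 (i - 1) (by omega) (by omega)
      omega
    refine ⟨(Finset.Icc 1 n).filter (· ∈ MesaSet n w), ?_, ?_⟩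
    · rw [goodSets_mem]
      constructor
      · intro x hx
        rw [Finset.mem_filter, Finset.mem_Icc] at hx
        have := hsub x hx.2
        rw [Finset.mem_Ico]; omega
      · intro m hm
        rcases Nat.eq_zero_or_pos n with h0 | h0
        · subst h0
          simp
        · have := mesa_bound_s18 n w hw (m + 1) (by omega) (by omega)
            ((Finset.Icc 1 n).filter (· ∈ MesaSet n w) ∩ Finset.Ico 2 (2 + m))
            (by
              intro a ha
              simp only [Finset.mem_inter, Finset.mem_filter, Finset.mem_Ico] at ha
              exact ⟨ha.1.2, by omega⟩)
          omega
    · ext a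
      simp only [Finset.coe_filter, Finset.mem_Icc, Set.mem_ofPred_eq, and_iff_right_iff_imp]
      intro ha
      have := hsub a ha
      omega
  · rintro ⟨M, hM, rfl⟩
    rw [goodSets_mem] at hM
    have h1 : 1 ∉ M := fun h => by have := hM.1 h; simp at this
    have h2 : M ⊆ Finset.Icc 1 n := by
      intro x hx
      have := hM.1 hx
      rw [Finset.mem_Ico] at this
      rw [Finset.mem_Icc]; omega
    apply mesa_exists n M h2
    intro m hm hmn
    have := hM.2 (m - 1) (by omega)
    rw [e2 M h1 h2 m hm] at this
    omega

theorem AMS_card_formula (k r : ℕ) (hr : r < 3) :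
    (AMS (3*k + r)).ncard =
      2^(3*k + r - 1) -
        ∑ i ∈ Finset.range k,
          2^(3*i + r) * ((3*(k-i) - 2).choose (2*(k-i) - 1) / (k - i)) := by
  rw [AMS_eq, Set.ncard_image_of_injective _ Finset.coe_injective, Set.ncard_coe_finset,
    goodSets_card, gpc_formula k r hr]
end
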